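/- Fujimoto's independence lemma: Let n be an odd natural number and t a natural number with 0 ≤ t ≤ (n − 1)/2. There exist mutually distinct complex numbers a₀, a₁, …, a_t, b₁, …, b_t such that, defining the (t + 1)·n polynomials f_{σ,i} ∈ ℂ[u] by f_{0,i}(u) = (u − a₀)^{n−i} for 1 ≤ i ≤ n, and f_{σ,i}(u) = (u − a_σ)^{n−i}(u − b_σ)^{i−1} for 1 ≤ σ ≤ t and 1 ≤ i ≤ n, every subset of n of these polynomials is linearly independent over ℂ. -/

import Mathlib

open Polynomial

/-- The family of polynomials of Fujimoto's independence lemma: for `s = 0`,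
`f_{0,i}(u) = (u − a₀)^{n−i}`, and for `1 ≤ s ≤ t`,
`f_{s,i}(u) = (u − a_s)^{n−i} (u − b_s)^{i−1}` (`1 ≤ i ≤ n`, here `i` is
represented by the index `i : Fin n` corresponding to `i+1`). -/
noncomputable def fujimotoPoly (n t : ℕ) (a : Fin (t + 1) → ℂ) (b : Fin t → ℂ)
    (s : Fin (t + 1)) (i : Fin n) : Polynomial ℂ :=
  if h : s.val = 0 then (X - C (a s)) ^ (n - 1 - i.val)
  else (X - C (a s)) ^ (n - 1 - i.val) *
    (X - C (b ⟨s.val - 1, by have := s.isLt; omega⟩)) ^ i.val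

lemma fuj_alpha (k : ℕ) (v : Fin k → ℕ) (hv : Function.Injective v) :
    ∃ α : Fin k → Fin k → ℂ, ∀ r j : Fin k,
      ∑ a, α r a * ((v a).choose j : ℂ) = if r = j then 1 else 0 := by
  let A : Matrix (Fin k) (Fin k) ℂ := Matrix.of fun a j => ((v a).choose j : ℂ)
  let D : Matrix (Fin k) (Fin k) ℂ := Matrix.of fun a j =>
    (descPochhammer ℂ (j : ℕ)).eval ((v a : ℂ))
  have hD : D.det ≠ 0 := by
    have h := Matrix.det_eval_matrixOfPolynomials_eq_det_vandermonde
      (fun a => (v a : ℂ)) (fun j : Fin k => descPochhammer ℂ (j : ℕ))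
      (fun j => descPochhammer_natDegree ℂ j) (fun j => monic_descPochhammer ℂ j)
    change D.det ≠ 0
    rw [show D.det = _ from h.symm, Matrix.det_vandermonde_ne_zero_iff]
    intro a b hab
    exact hv (Nat.cast_injective (R := ℂ) hab)
  have hDA : D = A * Matrix.diagonal (fun j : Fin k => ((j : ℕ).factorial : ℂ)) := by
    ext a j
    simp only [Matrix.mul_diagonal, D, A, Matrix.of_apply]
    rw [descPochhammer_eval_eq_descFactorial, Nat.descFactorial_eq_factorial_mul_choose]
    push_cast; ring
  have hA : IsUnit A.det := by
    rw [isUnit_iff_ne_zero]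
    intro h
    apply hD
    rw [hDA, Matrix.det_mul, h, zero_mul]
  refine ⟨fun r a => (A⁻¹ : Matrix (Fin k) (Fin k) ℂ) r a, fun r j => ?_⟩
  have := congrFun (congrFun (Matrix.nonsing_inv_mul A hA) r) j
  rw [Matrix.mul_apply, Matrix.one_apply] at this
  exact this

noncomputable def fujL (n : ℕ) : ℂ[X] →ₗ[ℂ] (Fin n → ℂ) :=
  LinearMap.pi (fun i => Polynomial.lcoeff ℂ i)

/-- limit polynomials -/
noncomputable def fujE (n t : ℕ) (s : Fin (t + 1)) (j : ℕ) : ℂ[X] :=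
  if s.val = 0 then X ^ j else (X - C (s.val : ℂ)) ^ (n - 1 - j)

noncomputable def fujH (n : ℕ) (φ : ℂ[X] →ₗ[ℂ] ℂ) (c : ℂ) : ℂ[X] :=
  ∑ j ∈ Finset.range n, C (((n - 1).choose j : ℂ) * (-1) ^ j * φ ((X - C c) ^ (n - 1 - j))) * X ^ j

lemma fujH_eval (n : ℕ) (hn : 0 < n) (φ : ℂ[X] →ₗ[ℂ] ℂ) (c y : ℂ) :
    (fujH n φ c).eval y = φ ((X - C (c + y)) ^ (n - 1)) := by
  have : (X - C (c + y) : ℂ[X]) = C (-y) + (X - C c) := by simp; ring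
  rw [this, add_pow, show n - 1 + 1 = n by omega, map_sum, fujH, eval_finsetSum]
  refine Finset.sum_congr rfl fun j _ => ?_
  have h2 : (C (-y) ^ j * (X - C c) ^ (n - 1 - j) * ((n - 1).choose j : ℂ[X]) : ℂ[X])
      = ((-y) ^ j * ((n - 1).choose j : ℂ)) • (X - C c) ^ (n - 1 - j) := by
    rw [smul_eq_C_mul]; simp; ring
  rw [h2, map_smul]
  simp
  rw [neg_pow y]; ring

lemma fujH_coeff (n : ℕ) (φ : ℂ[X] →ₗ[ℂ] ℂ) (c : ℂ) (j : ℕ) (hj : j < n) :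
    (fujH n φ c).coeff j = ((n - 1).choose j : ℂ) * (-1) ^ j * φ ((X - C c) ^ (n - 1 - j)) := by
  simp only [fujH, finsetSum_coeff, coeff_C_mul_X_pow]
  rw [Finset.sum_eq_single j]
  · simp
  · intro b _ hb; simp [hb.symm]
  · intro h; simp at h; omega

lemma fujH_degree (n : ℕ) (φ : ℂ[X] →ₗ[ℂ] ℂ) (c : ℂ) (j : ℕ) (hj : n ≤ j) :
    (fujH n φ c).coeff j = 0 := by
  simp only [fujH, finsetSum_coeff, coeff_C_mul_X_pow]
  apply Finset.sum_eq_zero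
  intro b hb; simp at hb; rw [if_neg]; omega

lemma fujH_comp (n : ℕ) (hn : 0 < n) (φ : ℂ[X] →ₗ[ℂ] ℂ) (c : ℂ) :
    fujH n φ 0 = (fujH n φ c).comp (X - C c) := by
  apply Polynomial.funext
  intro y
  rw [eval_comp, fujH_eval n hn, fujH_eval n hn]
  simp

lemma fujE_dual (n t : ℕ) (hn : 0 < n) (k : Fin (t + 1) → ℕ) (hk : ∑ s, k s = n)
    (φ : ℂ[X] →ₗ[ℂ] ℂ) (hφ : ∀ s, ∀ j < k s, φ (fujE n t s j) = 0) (j : ℕ) (hj : j < n) :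
    φ (X ^ j) = 0 := by
  have hkn : ∀ s, k s ≤ n := fun s => hk ▸
    Finset.single_le_sum (f := k) (fun _ _ => Nat.zero_le _) (Finset.mem_univ s)
  have hdvd : ∀ s : Fin (t + 1), s ≠ 0 → (X - C (s.val : ℂ)) ^ (k s) ∣ fujH n φ 0 := by
    intro s hs
    have h1 : X ^ (k s) ∣ fujH n φ (s.val : ℂ) := by
      rw [X_pow_dvd_iff]
      intro d hd
      rw [fujH_coeff _ _ _ _ (by have := hkn s; omega)]
      have := hφ s d hd
      rw [fujE, if_neg (show ¬ s.val = 0 from fun h => hs (Fin.ext h))] at this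
      rw [this, mul_zero]
    obtain ⟨q, hq⟩ := h1
    rw [fujH_comp n hn φ (s.val : ℂ), hq]
    simp
  have hprod : (∏ s ∈ Finset.univ.erase (0 : Fin (t + 1)), (X - C (s.val : ℂ)) ^ (k s)) ∣ fujH n φ 0 := by
    apply Finset.prod_dvd_of_coprime
    · intro a _ b _ hab
      apply IsCoprime.pow
      apply isCoprime_X_sub_C_of_isUnit_sub
      rw [isUnit_iff_ne_zero, sub_ne_zero]
      intro h
      exact hab (Fin.ext (by exact_mod_cast h))
    · intro s hs
      exact hdvd s (Finset.ne_of_mem_erase hs)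
  have hmon : (∏ s ∈ Finset.univ.erase (0 : Fin (t + 1)), (X - C (s.val : ℂ)) ^ (k s)).Monic :=
    monic_prod_of_monic _ _ fun s _ => (monic_X_sub_C _).pow _
  have hdeg : (∏ s ∈ Finset.univ.erase (0 : Fin (t + 1)), (X - C (s.val : ℂ)) ^ (k s)).natDegree = n - k 0 := by
    rw [natDegree_prod_of_monic _ _ fun s _ => (monic_X_sub_C _).pow _]
    simp only [natDegree_pow, natDegree_X_sub_C, mul_one]
    have := Finset.add_sum_erase Finset.univ k (Finset.mem_univ 0)
    omega
  have h0 : fujH n φ 0 = 0 := by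
    by_contra hne
    have hle := natDegree_le_of_dvd hprod hne
    rw [hdeg] at hle
    apply leadingCoeff_ne_zero.mpr hne
    rw [leadingCoeff]
    rcases lt_or_ge (fujH n φ 0).natDegree n with h | h
    · rw [fujH_coeff _ _ _ _ h]
      have := hφ 0 (n - 1 - (fujH n φ 0).natDegree) (by have := hkn 0; omega)
      rw [fujE, if_pos (by simp)] at this
      simp only [C_0, sub_zero, this, mul_zero]
    · exact fujH_degree _ _ _ _ h
  have := fujH_coeff n φ 0 (n - 1 - j) (by omega)
  rw [h0, coeff_zero, C_0, sub_zero, show n - 1 - (n - 1 - j) = j by omega] at this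
  have hc : ((n - 1).choose (n - 1 - j) : ℂ) ≠ 0 := by
    exact_mod_cast (Nat.choose_pos (by omega)).ne'
  have h3 := this.symm
  simpa [hc] using h3

lemma fujE_indep (n t : ℕ) (hn : 0 < n) (k : Fin (t + 1) → ℕ) (hk : ∑ s, k s = n) :
    LinearIndependent ℂ (fun p : (Σ s : Fin (t + 1), Fin (k s)) => fujL n (fujE n t p.1 p.2)) := by
  apply linearIndependent_of_top_le_span_of_card_eq_finrank
  · by_contra hlt
    have hlt' := lt_top_iff_ne_top.mpr (fun h => hlt (le_of_eq h.symm))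
    obtain ⟨φ, hφ0, hφ⟩ := Submodule.exists_le_ker_of_lt_top _ hlt'
    apply hφ0
    have key := fujE_dual n t hn k hk (φ ∘ₗ fujL n) (fun s j hj => by
      have : fujL n (fujE n t s j) ∈ LinearMap.ker φ :=
        hφ (Submodule.subset_span ⟨⟨s, ⟨j, hj⟩⟩, rfl⟩)
      simpa using this)
    apply LinearMap.pi_ext'
    intro i
    ext
    have := key i i.isLt
    have h2 : fujL n (X ^ (i : ℕ)) = Pi.single i 1 := by
      ext l
      simp [fujL, coeff_X_pow, Pi.single_apply, Fin.ext_iff]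
    rw [LinearMap.comp_apply, h2] at this
    simpa using this
  · simp [hk]

lemma fuj_core (n t : ℕ) (hn : 0 < n) (k : Fin (t + 1) → ℕ) (hk : ∑ s, k s = n)
    (v : ∀ s, Fin (k s) → ℕ) (hv : ∀ s, Function.Injective (v s)) :
    ∀ᶠ ε : ℂ in nhdsWithin 0 {0}ᶜ, ⊤ ≤ Submodule.span ℂ (Set.range
      (fun p : (Σ s : Fin (t + 1), Fin (k s)) => fujL n
        (∑ j ∈ Finset.range n, (((v p.1 p.2).choose j : ℂ) * (-ε) ^ j) • fujE n t p.1 j))) := by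
  have hkn : ∀ s, k s ≤ n := fun s => hk ▸
    Finset.single_le_sum (f := k) (fun _ _ => Nat.zero_le _) (Finset.mem_univ s)
  choose α hα using fun s => fuj_alpha (k s) (v s) (hv s)
  let G : ℂ → (Σ s : Fin (t + 1), Fin (k s)) → (Fin n → ℂ) := fun ε p =>
    ∑ j ∈ Finset.range n, (if j < k p.1 then (if (p.2 : ℕ) = j then (1 : ℂ) else 0) else
      (∑ a, α p.1 p.2 a * ((v p.1 a).choose j : ℂ)) * (-ε) ^ (j - p.2)) • fujL n (fujE n t p.1 j)
  have hG0 : G 0 = fun p => fujL n (fujE n t p.1 p.2) := by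
    funext p
    simp only [G]
    rw [Finset.sum_eq_single (p.2 : ℕ)]
    · simp
    · intro j _ hj
      split_ifs with h1 h2
      · exact absurd h2.symm hj
      · simp
      · have : j - p.2 ≠ 0 := by have := p.2.isLt; omega
        simp [this]
    · intro h
      have := hkn p.1
      have := p.2.isLt
      simp at h; omega
  have hGc : Continuous G := by
    apply continuous_pi
    intro p
    apply continuous_finsetSum
    intro j _
    split_ifs <;> fun_prop
  have hind : ∀ᶠ ε in nhds (0 : ℂ), LinearIndependent ℂ (G ε) := by
    have hop := (isOpen_setOfPred_linearIndependent (𝕜 := ℂ) (E := Fin n → ℂ)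
      (ι := Σ s : Fin (t + 1), Fin (k s))).preimage hGc
    refine hop.mem_nhds ?_
    change LinearIndependent ℂ (G 0)
    rw [hG0]
    exact fujE_indep n t hn k hk
  filter_upwards [hind.filter_mono nhdsWithin_le_nhds, self_mem_nhdsWithin] with ε hε hε0
  have hε0 : ε ≠ 0 := hε0
  have hspan := hε.span_eq_top_of_card_eq_finrank' (by simp [hk])
  rw [← hspan, Submodule.span_le]
  rintro _ ⟨p, rfl⟩
  have hrel : G ε p = ((-ε) ^ (p.2 : ℕ))⁻¹ • ∑ a, α p.1 p.2 a • fujL n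
        (∑ j ∈ Finset.range n, (((v p.1 a).choose j : ℂ) * (-ε) ^ j) • fujE n t p.1 j) := by
    have hne : (-ε) ^ (p.2 : ℕ) ≠ 0 := pow_ne_zero _ (neg_ne_zero.mpr hε0)
    rw [eq_inv_smul_iff₀ hne]
    simp only [G, map_sum, map_smul, Finset.smul_sum, smul_smul]
    rw [Finset.sum_comm]
    refine Finset.sum_congr rfl fun j _ => ?_
    rw [← Finset.sum_smul]
    congr 1
    have e1 : ∑ a, α p.1 p.2 a * (((v p.1 a).choose j : ℂ) * (-ε) ^ j)
        = (∑ a, α p.1 p.2 a * ((v p.1 a).choose j : ℂ)) * (-ε) ^ j := by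
      rw [Finset.sum_mul]; exact Finset.sum_congr rfl fun _ _ => by ring
    rw [e1]
    split_ifs with h1 h2
    · have := hα p.1 p.2 ⟨j, h1⟩
      rw [if_pos (Fin.ext h2)] at this
      rw [this, h2]; ring
    · have := hα p.1 p.2 ⟨j, h1⟩
      rw [if_neg (fun h => h2 (congrArg Fin.val h))] at this
      rw [this]; ring
    · have : j = p.2 + (j - p.2) := by have := p.2.isLt; omega
      conv_rhs => rw [this, pow_add]
      rw [← this]; ring
  rw [SetLike.mem_coe, hrel]
  refine Submodule.smul_mem _ _ (Submodule.sum_mem _ fun a _ => Submodule.smul_mem _ _ ?_)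
  exact Submodule.subset_span ⟨⟨p.1, a⟩, rfl⟩

noncomputable def fujA (t : ℕ) (ε : ℂ) (s : Fin (t + 1)) : ℂ := if s.val = 0 then ε⁻¹ else s.val
noncomputable def fujB (t : ℕ) (ε : ℂ) (s : Fin t) : ℂ := (s.val : ℂ) + 1 + ε

/-- exponent attached to an index -/
def fujM (n t : ℕ) (s : Fin (t + 1)) (i : Fin n) : ℕ := if s.val = 0 then n - 1 - i.val else i.val

lemma fujM_inj (n t : ℕ) (s : Fin (t + 1)) : Function.Injective (fujM n t s) := by
  intro i j h
  simp only [fujM] at h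
  ext
  split_ifs at h <;> omega

lemma fuj_expand_aux (n m : ℕ) (hm : m < n) (ε : ℂ) (g : ℕ → ℂ[X]) :
    ∑ j ∈ Finset.range n, ((m.choose j : ℂ) * (-ε) ^ j) • g j =
    ∑ j ∈ Finset.range (m + 1), ((m.choose j : ℂ) * (-ε) ^ j) • g j := by
  symm
  apply Finset.sum_subset
  · intro j; simp; omega
  · intro j _ hj
    rw [Nat.choose_eq_zero_of_lt (by simpa using hj)]; simp

lemma fuj_expand (n t : ℕ) (ε : ℂ) (hε : ε ≠ 0) (s : Fin (t + 1)) (i : Fin n) :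
    ∃ r : ℂ, ∑ j ∈ Finset.range n, (((fujM n t s i).choose j : ℂ) * (-ε) ^ j) • fujE n t s j =
      r • fujimotoPoly n t (fujA t ε) (fujB t ε) s i := by
  have hi := i.isLt
  rw [fuj_expand_aux n _ (by unfold fujM; split_ifs <;> omega)]
  by_cases h : s.val = 0
  · simp only [fujM, fujE, fujimotoPoly, fujA, h, if_true, dif_pos]
    refine ⟨(-ε) ^ (n - 1 - i.val), ?_⟩
    have : (-ε) ^ (n - 1 - i.val) • (X - C ε⁻¹) ^ (n - 1 - i.val) =
        (C (-ε) * X + 1) ^ (n - 1 - i.val) := by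
      rw [smul_eq_C_mul, C_pow, ← mul_pow]
      congr 1
      rw [mul_sub, ← C_mul]
      simp [hε]
    rw [this, add_pow]
    refine Finset.sum_congr rfl fun j _ => ?_
    rw [smul_eq_C_mul]
    simp [mul_pow]; ring
  · refine ⟨1, ?_⟩
    have hb : ((s.val - 1 : ℕ) : ℂ) + 1 = s.val := by
      have : s.val - 1 + 1 = s.val := by omega
      exact_mod_cast this
    simp only [fujM, fujE, fujimotoPoly, fujA, fujB, h, if_false, dif_neg, not_false_eq_true, one_smul, hb]
    have : (X - C ((s.val : ℂ) + ε)) = C (-ε) + (X - C (s.val : ℂ)) := by simp; ring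
    rw [this, add_pow, Finset.mul_sum]
    refine Finset.sum_congr rfl fun j hj => ?_
    rw [smul_eq_C_mul, show n - 1 - j = (n - 1 - i.val) + (i.val - j) by simp at hj; omega, pow_add]
    simp; ring

lemma fuj_S (n t : ℕ) (hn : 0 < n) (S : Finset (Fin (t + 1) × Fin n)) (hS : S.card = n) :
    ∀ᶠ ε : ℂ in nhdsWithin 0 {0}ᶜ, LinearIndependent ℂ
          (fun p : (S : Set (Fin (t + 1) × Fin n)) =>
            fujimotoPoly n t (fujA t ε) (fujB t ε) p.val.1 p.val.2) := by
  let I : Fin (t + 1) → Finset (Fin n) := fun s => Finset.univ.filter fun i => (s, i) ∈ S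
  have hk : ∑ s, (I s).card = n := by
    rw [← Finset.card_sigma]
    refine Eq.trans ?_ hS
    apply Finset.card_bij (fun p _ => (p.1, p.2))
    · rintro ⟨s, i⟩ h; simpa [I] using h
    · rintro ⟨s, i⟩ _ ⟨s', i'⟩ _ h
      simp only [Prod.mk.injEq] at h
      obtain ⟨rfl, rfl⟩ := h; rfl
    · rintro ⟨s, i⟩ h; exact ⟨⟨s, i⟩, by simpa [I] using h, rfl⟩
  have hcore := fuj_core n t hn (fun s => (I s).card) hk
    (fun s a => fujM n t s ((I s).orderEmbOfFin rfl a))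
    (fun s => (fujM_inj n t s).comp ((I s).orderEmbOfFin rfl).injective)
  filter_upwards [hcore, self_mem_nhdsWithin] with ε hε hε0
  have hε0 : ε ≠ 0 := hε0
  apply LinearIndependent.of_comp (fujL n)
  apply linearIndependent_of_top_le_span_of_card_eq_finrank
  · refine hε.trans ?_
    rw [Submodule.span_le]
    rintro _ ⟨⟨s, a⟩, rfl⟩
    obtain ⟨r, hr⟩ := fuj_expand n t ε hε0 s ((I s).orderEmbOfFin rfl a)
    simp only [SetLike.mem_coe]
    rw [hr, map_smul]
    apply Submodule.smul_mem
    have hmem := (I s).orderEmbOfFin_mem rfl a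
    exact Submodule.subset_span ⟨⟨(s, (I s).orderEmbOfFin rfl a), (Finset.mem_filter.mp hmem).2⟩, rfl⟩
  · simp [hS]

/-- Fujimoto's independence lemma (Lemma 5.16 of the paper): for odd n and
t ≤ (n−1)/2 there are mutually distinct complex numbers a₀,…,a_t,b₁,…,b_t such
that any n of the (t+1)n polynomials f_{s,i} are linearly independent over ℂ. -/
theorem stmt_10 (n t : ℕ) (hodd : Odd n) (ht : t ≤ (n - 1) / 2) :
    ∃ (a : Fin (t + 1) → ℂ) (b : Fin t → ℂ),
      Function.Injective a ∧ Function.Injective b ∧ (∀ σ τ, a σ ≠ b τ) ∧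
      ∀ S : Finset (Fin (t + 1) × Fin n), S.card = n →
        LinearIndependent ℂ
          (fun p : (S : Set (Fin (t + 1) × Fin n)) =>
            fujimotoPoly n t a b p.val.1 p.val.2) := by
  have hn : 0 < n := hodd.pos
  have hall : ∀ᶠ ε : ℂ in nhdsWithin 0 {0}ᶜ, ∀ S : Finset (Fin (t + 1) × Fin n), S.card = n →
      LinearIndependent ℂ (fun p : (S : Set (Fin (t + 1) × Fin n)) =>
            fujimotoPoly n t (fujA t ε) (fujB t ε) p.val.1 p.val.2) := by
    rw [Filter.eventually_all]
    intro S
    by_cases hS : S.card = n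
    · filter_upwards [fuj_S n t hn S hS] with ε h _ using h
    · exact Filter.Eventually.of_forall fun _ h => absurd h hS
  have hpos : (0 : ℝ) < ((t : ℝ) + 2)⁻¹ := by positivity
  have hsmall : ∀ᶠ ε : ℂ in nhdsWithin 0 {0}ᶜ, ‖ε‖ < ((t : ℝ) + 2)⁻¹ :=
    Filter.Eventually.filter_mono nhdsWithin_le_nhds (by
      filter_upwards [Metric.ball_mem_nhds (0 : ℂ) hpos] with ε h
      simpa using h)
  have h0 : ∀ᶠ ε : ℂ in nhdsWithin 0 {0}ᶜ, ε ≠ 0 := self_mem_nhdsWithin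
  obtain ⟨ε, hS, hlt, hne⟩ := (hall.and (hsmall.and h0)).exists
  have hnp : 0 < ‖ε‖ := norm_pos_iff.mpr hne
  have hinv : (t : ℝ) + 2 < ‖ε⁻¹‖ := by
    rw [norm_inv]; exact (lt_inv_comm₀ hnp (by positivity)).mp hlt
  have hlt1 : ‖ε‖ < 1 := hlt.trans_le (inv_le_one_of_one_le₀ (by
    have : (0 : ℝ) ≤ t := Nat.cast_nonneg t
    linarith))
  have hbig : ∀ m : ℕ, m ≤ t → ε⁻¹ ≠ (m : ℂ) := by
    intro m hm h
    rw [h, Complex.norm_natCast] at hinv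
    have : (m : ℝ) ≤ t := by exact_mod_cast hm
    linarith
  refine ⟨fujA t ε, fujB t ε, ?_, ?_, ?_, hS⟩
  · intro x y h
    have hx := x.isLt
    have hy := y.isLt
    simp only [fujA] at h
    ext
    split_ifs at h with h1 h2 h2
    · omega
    · exact absurd h (hbig _ (by omega))
    · exact absurd h.symm (hbig _ (by omega))
    · exact_mod_cast h
  · intro x y h
    simp only [fujB, add_left_inj] at h
    ext
    exact_mod_cast h
  · intro x y h
    have hx := x.isLt
    have hy := y.isLt
    simp only [fujA, fujB] at h
    split_ifs at h with h1
    · rw [h] at hinv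
      have h3 : ‖(y.val : ℂ) + 1 + ε‖ ≤ ‖((y.val + 1 : ℕ) : ℂ)‖ + ‖ε‖ := by
        push_cast; exact norm_add_le _ _
      rw [Complex.norm_natCast] at h3
      have : ((y.val + 1 : ℕ) : ℝ) ≤ t := by exact_mod_cast hy
      linarith
    · have he : ε = (((x.val : ℤ) - y.val - 1 : ℤ) : ℂ) := by
        push_cast; rw [h]; ring
      rw [he, Complex.norm_intCast] at hlt1
      have h4 : |(x.val : ℤ) - y.val - 1| < 1 := by exact_mod_cast hlt1
      rw [Int.abs_lt_one_iff] at h4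
      rw [h4] at he
      simp at he
      exact hne he
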